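/- Let G be an infinite connected graph with all degrees at most M < ∞, and suppose there are constants A, B < ∞ and exponents α, β ∈ (0,1] such that H_n* ≤ A·n^α and TV_n ≤ B·n^{−β} for all n ≥ 1. Then there is a constant C < ∞ such that the isoperimetric profile of G satisfies Φ(n) ≤ C·(log log n / log n)^{β/α} for all n ≥ 3. -/

import Mathlib

open scoped Classical BigOperators

namespace LazyRW

variable {V : Type*}

/-- One-step transition kernel of the lazy simple random walk. -/
noncomputable def step (G : SimpleGraph V) [G.LocallyFinite] (x y : V) : ℝ :=
  if x = y then 1/2 else if G.Adj x y then 1 / (2 * (G.degree x)) else 0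

/-- Probability of a given path of length `n` for the lazy walk started at `x`. -/
noncomputable def pathProb (G : SimpleGraph V) [G.LocallyFinite]
    (n : ℕ) (x : V) (p : Fin (n+1) → V) : ℝ :=
  (if p 0 = x then 1 else 0) * ∏ i : Fin n, step G (p i.castSucc) (p i.succ)

/-- Probability of an event determined by the first `n` steps of the lazy walk started at `x`. -/
noncomputable def walkProb (G : SimpleGraph V) [G.LocallyFinite]
    (n : ℕ) (x : V) (E : Set (Fin (n+1) → V)) : ℝ :=
  ∑' p : (Fin (n+1) → V), pathProb G n x p * E.indicator (fun _ => (1:ℝ)) p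

/-- Expectation of a functional of the first `n` steps of the lazy walk started at `x`. -/
noncomputable def walkExp (G : SimpleGraph V) [G.LocallyFinite]
    (n : ℕ) (x : V) (f : (Fin (n+1) → V) → ℝ) : ℝ :=
  ∑' p : (Fin (n+1) → V), pathProb G n x p * f p

/-- `n`-th power of the lazy transition matrix. -/
noncomputable def Pmat (G : SimpleGraph V) [G.LocallyFinite] : ℕ → V → V → ℝ
  | 0, x, y => if x = y then 1 else 0
  | (n+1), x, y => ∑' z, Pmat G n x z * step G z y

/-- Total variation profile `TV_n`. -/
noncomputable def TV (G : SimpleGraph V) [G.LocallyFinite] (n : ℕ) : ℝ :=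
  ⨆ e : {p : V × V // G.Adj p.1 p.2},
    (1/2) * ∑' z, |Pmat G n e.val.1 z - Pmat G n e.val.2 z|

/-- Expected graph-distance displacement at time `m`. -/
noncomputable def expDist (G : SimpleGraph V) [G.LocallyFinite] (m : ℕ) (x : V) : ℝ :=
  walkExp G m x (fun p => (G.dist (p 0) (p (Fin.last m)) : ℝ))

/-- `D_n^*`: supremal expected displacement up to time `n`. -/
noncomputable def Dstar (G : SimpleGraph V) [G.LocallyFinite] (n : ℕ) : ℝ :=
  ⨆ x : V, ⨆ m : Fin (n+1), expDist G m.1 x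

/-- Entropy of the walk at time `m` started at `x`. -/
noncomputable def entropy (G : SimpleGraph V) [G.LocallyFinite] (m : ℕ) (x : V) : ℝ :=
  ∑' y : V, Real.negMulLog (Pmat G m x y)

/-- `H_n^*`: supremal entropy up to time `n`. -/
noncomputable def Hstar (G : SimpleGraph V) [G.LocallyFinite] (n : ℕ) : ℝ :=
  ⨆ x : V, ⨆ m : Fin (n+1), entropy G m.1 x

/-- `|∂W|`: the number of edges with exactly one endpoint in `W`. -/
noncomputable def boundaryCard (G : SimpleGraph V) [G.LocallyFinite] (W : Finset V) : ℕ :=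
  ∑ w ∈ W, ((G.neighborFinset w).filter (fun z => z ∉ W)).card

/-- `deg(W)`: the sum of degrees of vertices in `W`. -/
noncomputable def degSum (G : SimpleGraph V) [G.LocallyFinite] (W : Finset V) : ℕ :=
  ∑ w ∈ W, G.degree w

/-- The isoperimetric profile `Φ(n)`. -/
noncomputable def isoProfile (G : SimpleGraph V) [G.LocallyFinite] (n : ℕ) : ℝ :=
  ⨅ W : {W : Finset V // W.Nonempty ∧ degSum G W ≤ n},
    (boundaryCard G W.1 : ℝ) / (degSum G W.1 : ℝ)

/-- `q_m(u,v)`: probability that the lazy walk started at `u` first visits `v` at time `m`. -/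
noncomputable def firstHit (G : SimpleGraph V) [G.LocallyFinite] (m : ℕ) (u v : V) : ℝ :=
  walkProb G m u {p | p (Fin.last m) = v ∧ ∀ i : Fin (m+1), i ≠ Fin.last m → p i ≠ v}

/-- The massive Green function `G_t(u,v)`. -/
noncomputable def greenT (G : SimpleGraph V) [G.LocallyFinite] (t : ℝ) (u v : V) : ℝ :=
  ∑' m : ℕ, (t/(t+1))^m * firstHit G m u v


noncomputable def adjR (G : SimpleGraph V) (x y : V) : ℝ := if G.Adj x y then 1 else 0

lemma adjR_comm (G : SimpleGraph V) (x y : V) : adjR G x y = adjR G y x := by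
  unfold adjR; simp only [G.adj_comm]

lemma adjR_nonneg (G : SimpleGraph V) (x y : V) : 0 ≤ adjR G x y := by
  unfold adjR; split_ifs <;> norm_num

section
variable (G : SimpleGraph V) [G.LocallyFinite]

lemma sum_adjR_eq (T : Finset V) (x : V) (f : V → ℝ)
    (h : ∀ y, G.Adj x y → y ∉ T → f y = 0) :
    ∑ y ∈ T, adjR G x y * f y = ∑ y ∈ G.neighborFinset x, f y := by
  have h1 : ∑ y ∈ T, adjR G x y * f y = ∑ y ∈ T ∪ G.neighborFinset x, adjR G x y * f y := by
    apply Finset.sum_subset Finset.subset_union_left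
    intro y hy hyT
    by_cases ha : G.Adj x y
    · rw [h y ha hyT, mul_zero]
    · simp [adjR, ha]
  have h2 : ∑ y ∈ G.neighborFinset x, f y = ∑ y ∈ G.neighborFinset x, adjR G x y * f y := by
    apply Finset.sum_congr rfl
    intro y hy
    rw [SimpleGraph.mem_neighborFinset] at hy
    simp [adjR, hy]
  rw [h1, h2]
  symm
  apply Finset.sum_subset Finset.subset_union_right
  intro y hy hyT
  rw [SimpleGraph.mem_neighborFinset] at hyT
  simp [adjR, hyT]

lemma sum_adjR_deg (T : Finset V) (x : V) (h : G.neighborFinset x ⊆ T) :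
    ∑ y ∈ T, adjR G x y = G.degree x := by
  have := sum_adjR_eq G T x (fun _ => 1) (by
    intro y hy hyT
    exact absurd (h (by simpa using hy)) hyT)
  simpa using this

lemma sum_adjR_le (T : Finset V) (x : V) :
    ∑ y ∈ T, adjR G x y ≤ G.degree x := by
  rw [← sum_adjR_deg G (T ∪ G.neighborFinset x) x Finset.subset_union_right]
  exact Finset.sum_le_sum_of_subset_of_nonneg Finset.subset_union_left
    (fun y _ _ => adjR_nonneg G x y)

noncomputable def ind (W : Finset V) (x : V) : ℝ := if x ∈ W then 1 else 0

lemma sum_ind_boundary (T W : Finset V) (hW : W ⊆ T)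
    (hN : ∀ x ∈ W, G.neighborFinset x ⊆ T) :
    ∑ x ∈ T, ∑ y ∈ T, adjR G x y * |ind W x - ind W y| = 2 * (boundaryCard G W : ℝ) := by
  have h1 : ∑ x ∈ T, ∑ y ∈ T, adjR G x y * (ind W x * (1 - ind W y)) = boundaryCard G W := by
    have : ∀ x ∈ T, ∑ y ∈ T, adjR G x y * (ind W x * (1 - ind W y))
        = if x ∈ W then (((G.neighborFinset x).filter (fun z => z ∉ W)).card : ℝ) else 0 := by
      intro x hx
      by_cases hxW : x ∈ W
      · rw [sum_adjR_eq G T x (fun y => ind W x * (1 - ind W y))]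
        · simp only [hxW, if_true, Finset.card_filter, Nat.cast_sum]
          apply Finset.sum_congr rfl
          intro y _
          by_cases hy : y ∈ W <;> simp [ind, hxW, hy]
        · intro y hy hyT
          exact absurd (hN x hxW (by simpa using hy)) hyT
      · simp [ind, hxW]
    rw [Finset.sum_congr rfl this, ← Finset.sum_filter]
    unfold boundaryCard
    push_cast
    apply Finset.sum_congr _ (fun _ _ => rfl)
    ext x; simp only [Finset.mem_filter]
    exact ⟨fun h => h.2, fun h => ⟨hW h, h⟩⟩
  have h2 : ∑ x ∈ T, ∑ y ∈ T, adjR G x y * (ind W y * (1 - ind W x)) = boundaryCard G W := by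
    rw [← h1, Finset.sum_comm]
    apply Finset.sum_congr rfl; intro x _
    apply Finset.sum_congr rfl; intro y _
    rw [adjR_comm]
  rw [two_mul]
  nth_rewrite 1 [← h1]
  rw [← h2, ← Finset.sum_add_distrib]
  apply Finset.sum_congr rfl; intro x _
  rw [← Finset.sum_add_distrib]
  apply Finset.sum_congr rfl; intro y _
  by_cases hx : x ∈ W <;> by_cases hy : y ∈ W <;> simp [ind, hx, hy]

lemma coarea (φ : ℝ) (T : Finset V) (S : Finset V) :
    ∀ f : V → ℝ, (∀ x ∉ S, f x = 0) → (∀ x, 0 ≤ f x) → S ⊆ T →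
    (∀ x ∈ S, G.neighborFinset x ⊆ T) →
    (∀ W : Finset V, W ⊆ S → W.Nonempty → φ * (degSum G W : ℝ) ≤ boundaryCard G W) →
    2 * φ * ∑ x ∈ T, G.degree x * f x ≤ ∑ x ∈ T, ∑ y ∈ T, adjR G x y * |f x - f y| := by
  induction S using Finset.strongInduction with
  | H S ih =>
  intro f hf0 hfn hST hN hφ
  rcases S.eq_empty_or_nonempty with hS | hS
  · subst hS
    have : ∀ x, f x = 0 := fun x => hf0 x (by simp)
    simp [this]
  · obtain ⟨x0, hx0, hmin⟩ := Finset.exists_min_image S f hS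
    set c := f x0 with hc
    set g : V → ℝ := fun x => f x - c * ind S x with hg
    have hc0 : 0 ≤ c := hfn x0
    have key := ih (S.erase x0) (Finset.erase_ssubset hx0) g
      (by
        intro x hx
        by_cases hxS : x ∈ S
        · have : x = x0 := by
            by_contra hne
            exact hx (Finset.mem_erase.2 ⟨hne, hxS⟩)
          subst this
          simp [hg, ind, hxS, hc]
        · simp [hg, ind, hxS, hf0 x hxS])
      (by
        intro x
        by_cases hxS : x ∈ S
        · have := hmin x hxS
          simp [hg, ind, hxS, this]
        · simp [hg, ind, hxS, hf0 x hxS])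
      ((Finset.erase_subset _ _).trans hST)
      (fun x hx => hN x (Finset.mem_of_mem_erase hx))
      (fun W hW => hφ W (hW.trans (Finset.erase_subset _ _)))
    have hb := sum_ind_boundary G T S hST hN
    have hd : ∑ x ∈ T, G.degree x * f x = ∑ x ∈ T, G.degree x * g x + c * degSum G S := by
      have : (degSum G S : ℝ) = ∑ x ∈ T, G.degree x * ind S x := by
        unfold degSum ind
        push_cast
        simp only [mul_ite, mul_one, mul_zero, ← Finset.sum_filter]
        apply Finset.sum_congr _ (fun _ _ => rfl)
        ext x; simp only [Finset.mem_filter]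
        exact ⟨fun h => ⟨hST h, h⟩, fun h => h.2⟩
      rw [this, Finset.mul_sum, ← Finset.sum_add_distrib]
      apply Finset.sum_congr rfl; intro x _
      simp only [hg]; ring
    have he : ∑ x ∈ T, ∑ y ∈ T, adjR G x y * |f x - f y|
        = ∑ x ∈ T, ∑ y ∈ T, adjR G x y * |g x - g y|
          + c * ∑ x ∈ T, ∑ y ∈ T, adjR G x y * |ind S x - ind S y| := by
      rw [Finset.mul_sum, ← Finset.sum_add_distrib]
      apply Finset.sum_congr rfl; intro x _
      rw [Finset.mul_sum, ← Finset.sum_add_distrib]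
      apply Finset.sum_congr rfl; intro y _
      by_cases hx : x ∈ S <;> by_cases hy : y ∈ S
      · simp [hg, ind, hx, hy]
      · have h1 := hmin x hx
        simp only [hg, ind, hx, hy, hf0 y hy, if_true, if_false]
        rw [abs_of_nonneg (by linarith), abs_of_nonneg (by linarith), abs_of_nonneg (by norm_num)]
        ring
      · have h1 := hmin y hy
        simp only [hg, ind, hx, hy, hf0 x hx, if_true, if_false]
        rw [abs_of_nonpos (by linarith), abs_of_nonpos (by linarith), abs_of_nonpos (by norm_num)]
        ring
      · simp [hg, ind, hx, hy]
    rw [hd, he, hb]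
    have := mul_le_mul_of_nonneg_left (hφ S subset_rfl hS) hc0
    linarith

/-- one step of the lazy operator acting on functions -/
noncomputable def lazyOp (f : V → ℝ) (x : V) : ℝ :=
  f x / 2 + (∑ y ∈ G.neighborFinset x, f y) / (2 * G.degree x)

lemma contraction (φ : ℝ) (hφ0 : 0 < φ) (T S : Finset V) (f : V → ℝ)
    (hd : ∀ x, 0 < G.degree x)
    (hf0 : ∀ x ∉ S, f x = 0) (hST : S ⊆ T)
    (hN : ∀ x ∈ S, G.neighborFinset x ⊆ T)
    (hφ : ∀ W : Finset V, W.Nonempty → φ * (degSum G W : ℝ) ≤ boundaryCard G W) :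
    ∑ x ∈ T, G.degree x * (lazyOp G f x) ^ 2
      ≤ (1 - φ ^ 2 / 4) * ∑ x ∈ T, G.degree x * f x ^ 2 := by
  have hco := coarea G φ T S (fun x => f x ^ 2) (fun x hx => by simp [hf0 x hx])
    (fun x => sq_nonneg _) hST hN (fun W _ => hφ W)
  set D := ∑ x ∈ T, G.degree x * f x ^ 2 with hD
  have hA1 : ∑ x ∈ T, ∑ y ∈ T, adjR G x y * f x ^ 2 = D := by
    rw [hD]
    apply Finset.sum_congr rfl; intro x hx
    rw [← Finset.sum_mul]
    by_cases hxS : x ∈ S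
    · rw [sum_adjR_deg G T x (hN x hxS)]
    · simp [hf0 x hxS]
  have hA2 : ∑ x ∈ T, ∑ y ∈ T, adjR G x y * f y ^ 2 = D := by
    rw [← hA1, Finset.sum_comm]
    apply Finset.sum_congr rfl; intro x _
    apply Finset.sum_congr rfl; intro y _
    rw [adjR_comm]
  set I := ∑ x ∈ T, ∑ y ∈ T, adjR G x y * (f x * f y) with hI
  have hE : ∑ x ∈ T, ∑ y ∈ T, adjR G x y * |f x ^ 2 - f y ^ 2|
      ≤ ∑ x ∈ T, ∑ y ∈ T, ((1/φ + φ/4) * (adjR G x y * f x ^ 2)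
        + (1/φ + φ/4) * (adjR G x y * f y ^ 2) + (φ/2 - 2/φ) * (adjR G x y * (f x * f y))) := by
    apply Finset.sum_le_sum; intro x _
    apply Finset.sum_le_sum; intro y _
    have h1 : |f x ^ 2 - f y ^ 2| ≤ (1/φ) * (f x - f y) ^ 2 + φ / 4 * (f x + f y) ^ 2 := by
      have h2 : |f x ^ 2 - f y ^ 2| = |f x - f y| * |f x + f y| := by
        rw [← abs_mul]; congr 1; ring
      rw [h2, ← sq_abs (f x - f y), ← sq_abs (f x + f y)]
      set a := |f x - f y|
      set b := |f x + f y|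
      have : (1/φ) * a ^ 2 + φ / 4 * b ^ 2 - a * b = (1/φ) * (a - φ / 2 * b) ^ 2 := by
        field_simp; ring
      have h3 : 0 ≤ (1/φ) * (a - φ / 2 * b) ^ 2 := by positivity
      linarith
    have := mul_le_mul_of_nonneg_left h1 (adjR_nonneg G x y)
    refine this.trans (le_of_eq ?_)
    ring
  simp only [Finset.sum_add_distrib, ← Finset.mul_sum] at hE
  rw [hA1, hA2, ← hI] at hE
  have hI2 : φ ^ 2 * D ≤ 2 * D - 2 * I := by
    have h3 : 2 * φ * D ≤ (1/φ + φ/4) * D + (1/φ + φ/4) * D + (φ/2 - 2/φ) * I := hco.trans hE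
    have h4 := mul_le_mul_of_nonneg_left h3 hφ0.le
    have h5 : φ * ((1/φ + φ/4) * D + (1/φ + φ/4) * D + (φ/2 - 2/φ) * I)
       = 2 * D + φ^2/2 * D + (φ^2/2 - 2) * I := by field_simp; ring
    rw [h5] at h4
    have h6 : φ^2/2 * I ≤ φ^2/2 * D := by
      apply mul_le_mul_of_nonneg_left _ (by positivity)
      have : 0 ≤ ∑ x ∈ T, ∑ y ∈ T, (adjR G x y * f x ^ 2 + adjR G x y * f y ^ 2
          - 2 * (adjR G x y * (f x * f y))) := by
        apply Finset.sum_nonneg; intro x _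
        apply Finset.sum_nonneg; intro y _
        have := mul_nonneg (adjR_nonneg G x y) (sq_nonneg (f x - f y))
        linarith
      simp only [Finset.sum_add_distrib, Finset.sum_sub_distrib, ← Finset.mul_sum] at this
      rw [hA1, hA2, ← hI] at this
      linarith
    linarith
  have hP : ∑ x ∈ T, G.degree x * (lazyOp G f x) ^ 2 ≤ ∑ x ∈ T, ((1/4) * (G.degree x * f x ^ 2)
      + (1/2) * ∑ y ∈ T, adjR G x y * (f x * f y) + (1/4) * ∑ y ∈ T, adjR G x y * f y ^ 2) := by
    apply Finset.sum_le_sum; intro x _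
    have hnot : ∀ y, y ∉ T → f y = 0 := fun y hy => hf0 y (fun h => hy (hST h))
    have e1 : ∑ y ∈ T, adjR G x y * (f x * f y) = f x * ∑ y ∈ G.neighborFinset x, f y := by
      rw [sum_adjR_eq G T x (fun y => f x * f y) (fun y _ hy => by simp [hnot y hy]),
        Finset.mul_sum]
    have e2 : ∑ y ∈ T, adjR G x y * f y ^ 2 = ∑ y ∈ G.neighborFinset x, f y ^ 2 := by
      rw [sum_adjR_eq G T x (fun y => f y ^ 2) (fun y _ hy => by simp [hnot y hy])]
    rw [e1, e2]
    have cs := sq_sum_le_card_mul_sum_sq (s := G.neighborFinset x) (f := f)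
    rw [SimpleGraph.card_neighborFinset_eq_degree] at cs
    unfold lazyOp
    have hdx : (0:ℝ) < G.degree x := by exact_mod_cast hd x
    set q := ∑ y ∈ G.neighborFinset x, f y
    set r := ∑ y ∈ G.neighborFinset x, f y ^ 2
    have : (G.degree x : ℝ) * (f x / 2 + q / (2 * G.degree x)) ^ 2
      = 1/4 * (G.degree x * f x ^ 2) + 1/2 * (f x * q) + 1/4 * (q ^ 2 / G.degree x) := by
      field_simp; ring
    rw [this]
    have h7 : q ^ 2 / G.degree x ≤ r := by
      rw [div_le_iff₀ hdx]; linarith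
    linarith
  simp only [Finset.sum_add_distrib, ← Finset.mul_sum] at hP
  rw [hA2, ← hI, ← hD] at hP
  linarith

end
section
variable (G : SimpleGraph V) [G.LocallyFinite]

noncomputable def nb (x : V) : Finset V := insert x (G.neighborFinset x)

lemma mem_nb {x y : V} : y ∈ nb G x ↔ y = x ∨ G.Adj x y := by
  simp [nb]

lemma step_nonneg (x y : V) : 0 ≤ step G x y := by
  unfold step; split_ifs <;> positivity

lemma step_eq_zero {x y : V} (h : y ∉ nb G x) : step G x y = 0 := by
  rw [mem_nb] at h
  push Not at h
  unfold step
  rw [if_neg (Ne.symm h.1), if_neg h.2]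

lemma mem_nb_comm {x y : V} : y ∈ nb G x ↔ x ∈ nb G y := by
  rw [mem_nb, mem_nb, G.adj_comm, eq_comm]

lemma Pmat_succ (n : ℕ) (x y : V) :
    Pmat G (n+1) x y = ∑ z ∈ nb G y, Pmat G n x z * step G z y := by
  rw [Pmat]
  apply tsum_eq_sum
  intro z hz
  rw [step_eq_zero G (fun h => hz ((mem_nb_comm G).1 h)), mul_zero]

lemma Pmat_left (n : ℕ) : ∀ x y : V,
    Pmat G (n+1) x y = ∑ z ∈ nb G x, step G x z * Pmat G n z y := by
  induction n with
  | zero =>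
    intro x y
    rw [Pmat_succ]
    simp only [Pmat, ite_mul, one_mul, zero_mul, mul_ite, mul_one, mul_zero, Finset.sum_ite_eq,
      Finset.sum_ite_eq']
    by_cases h : x ∈ nb G y
    · rw [if_pos h, if_pos ((mem_nb_comm G).1 h)]
    · rw [if_neg h, if_neg (fun h' => h ((mem_nb_comm G).1 h'))]
  | succ n ih =>
    intro x y
    rw [Pmat_succ]
    simp only [ih, Finset.sum_mul]
    rw [Finset.sum_comm]
    apply Finset.sum_congr rfl; intro w _
    rw [← ih, Pmat_succ, Finset.mul_sum]
    apply Finset.sum_congr rfl; intro z _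
    ring

lemma Pmat_nonneg (n : ℕ) : ∀ x y : V, 0 ≤ Pmat G n x y := by
  induction n with
  | zero => intro x y; rw [Pmat]; split_ifs <;> norm_num
  | succ n ih =>
    intro x y
    rw [Pmat_succ]
    exact Finset.sum_nonneg (fun z _ => mul_nonneg (ih _ _) (step_nonneg G _ _))

lemma step_rev (hd : ∀ x, 0 < G.degree x) (x y : V) :
    G.degree x * step G x y = G.degree y * step G y x := by
  have hx : (0:ℝ) < G.degree x := by exact_mod_cast hd x
  have hy : (0:ℝ) < G.degree y := by exact_mod_cast hd y
  unfold step
  by_cases h : x = y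
  · subst h; rfl
  · rw [if_neg h, if_neg (Ne.symm h)]
    by_cases ha : G.Adj x y
    · rw [if_pos ha, if_pos ha.symm]; field_simp
    · rw [if_neg ha, if_neg (fun h' => ha h'.symm)]; simp

lemma Pmat_rev (hd : ∀ x, 0 < G.degree x) (n : ℕ) : ∀ x y : V,
    G.degree x * Pmat G n x y = G.degree y * Pmat G n y x := by
  induction n with
  | zero =>
    intro x y
    by_cases h : x = y
    · subst h; rfl
    · simp [Pmat, h, Ne.symm h]
  | succ n ih =>
    intro x y
    rw [Pmat_succ, Pmat_left, Finset.mul_sum, Finset.mul_sum]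
    apply Finset.sum_congr rfl; intro z _
    rw [← mul_assoc, ih, ← mul_assoc, step_rev G hd y z]
    ring

lemma sum_nb (x : V) (f : V → ℝ) :
    ∑ y ∈ nb G x, step G x y * f y = lazyOp G f x := by
  unfold nb lazyOp
  rw [Finset.sum_insert (by simp), Finset.sum_div]
  congr 1
  · simp [step]; ring
  · apply Finset.sum_congr rfl; intro y hy
    rw [SimpleGraph.mem_neighborFinset] at hy
    simp only [step, if_neg hy.ne, if_pos hy]
    ring

lemma sum_step (hd : ∀ x, 0 < G.degree x) (x : V) : ∑ y ∈ nb G x, step G x y = 1 := by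
  have := sum_nb G x (fun _ => 1)
  simp only [mul_one] at this
  rw [this]
  have hx : (0:ℝ) < G.degree x := by exact_mod_cast hd x
  simp [lazyOp]
  field_simp; norm_num

lemma Pmat_lazy (n : ℕ) (z : V) :
    (fun x => Pmat G (n+1) x z) = lazyOp G (fun x => Pmat G n x z) := by
  funext x
  rw [Pmat_left, sum_nb]

lemma exists_supp1 (n : ℕ) : ∀ y, ∃ U : Finset V, ∀ z ∉ U, Pmat G n y z = 0 := by
  induction n with
  | zero =>
    intro y
    refine ⟨{y}, fun z hz => ?_⟩
    rw [Finset.mem_singleton] at hz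
    simp [Pmat, Ne.symm hz]
  | succ n ih =>
    intro y
    choose U hU using ih
    refine ⟨(nb G y).biUnion U, fun z hz => ?_⟩
    rw [Pmat_left]
    apply Finset.sum_eq_zero
    intro w hw
    rw [hU w z, mul_zero]
    intro h
    exact hz (Finset.mem_biUnion.2 ⟨w, hw, h⟩)

lemma exists_supp (n : ℕ) (Y : Finset V) : ∃ U : Finset V, ∀ y ∈ Y, ∀ z ∉ U, Pmat G n y z = 0 := by
  choose U hU using exists_supp1 G n
  refine ⟨Y.biUnion U, fun y hy z hz => hU y z ?_⟩
  intro h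
  exact hz (Finset.mem_biUnion.2 ⟨y, hy, h⟩)

lemma Pmat_hasSum (hd : ∀ x, 0 < G.degree x) (n : ℕ) : ∀ x, HasSum (Pmat G n x) 1 := by
  induction n with
  | zero =>
    intro x
    have : Pmat G 0 x = fun y => if y = x then 1 else 0 := by
      funext y; simp [Pmat, eq_comm]
    rw [this]
    exact hasSum_ite_eq x 1
  | succ n ih =>
    intro x
    have : Pmat G (n+1) x = fun y => ∑ z ∈ nb G x, step G x z * Pmat G n z y := by
      funext y; rw [Pmat_left]
    rw [this, ← sum_step G hd x]
    apply hasSum_sum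
    intro z _
    simpa using (ih z).mul_left (step G x z)

lemma Pmat_sum_le (hd : ∀ x, 0 < G.degree x) (n : ℕ) (x : V) (U : Finset V) :
    ∑ y ∈ U, Pmat G n x y ≤ 1 :=
  sum_le_hasSum U (fun y _ => Pmat_nonneg G n x y) (Pmat_hasSum G hd n x)

lemma Pmat_sum_eq (hd : ∀ x, 0 < G.degree x) (n : ℕ) (x : V) (U : Finset V)
    (hU : ∀ z ∉ U, Pmat G n x z = 0) :
    ∑ y ∈ U, Pmat G n x y = 1 := by
  have h := (Pmat_hasSum G hd n x).tsum_eq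
  rwa [tsum_eq_sum hU] at h

lemma Pmat_le_one (hd : ∀ x, 0 < G.degree x) (n : ℕ) (x y : V) : Pmat G n x y ≤ 1 := by
  simpa using Pmat_sum_le G hd n x {y}

lemma entropy_eq (n : ℕ) (x : V) (U : Finset V) (hU : ∀ z ∉ U, Pmat G n x z = 0) :
    entropy G n x = ∑ z ∈ U, Real.negMulLog (Pmat G n x z) := by
  unfold entropy
  apply tsum_eq_sum
  intro z hz
  simp [hU z hz]

lemma l1_le_two (hd : ∀ x, 0 < G.degree x) (n : ℕ) (x y : V) :
    ∑' z, |Pmat G n x z - Pmat G n y z| ≤ 2 := by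
  obtain ⟨U, hU⟩ := exists_supp G n {x, y}
  have hx := hU x (by simp)
  have hy := hU y (by simp)
  rw [tsum_eq_sum (s := U) (fun z hz => by simp [hx z hz, hy z hz])]
  calc ∑ z ∈ U, |Pmat G n x z - Pmat G n y z| ≤ ∑ z ∈ U, (Pmat G n x z + Pmat G n y z) := by
        apply Finset.sum_le_sum; intro z _
        rw [abs_le]
        constructor <;> linarith [Pmat_nonneg G n x z, Pmat_nonneg G n y z]
    _ ≤ 2 := by
        rw [Finset.sum_add_distrib]
        linarith [Pmat_sum_le G hd n x U, Pmat_sum_le G hd n y U]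

lemma l1_le_TV (hd : ∀ x, 0 < G.degree x) (n : ℕ) (x y : V) (h : G.Adj x y) :
    ∑' z, |Pmat G n x z - Pmat G n y z| ≤ 2 * TV G n := by
  have hb : BddAbove (Set.range (fun e : {p : V × V // G.Adj p.1 p.2} =>
      (1/2 : ℝ) * ∑' z, |Pmat G n e.val.1 z - Pmat G n e.val.2 z|)) := by
    refine ⟨1, ?_⟩
    rintro _ ⟨e, rfl⟩
    have := l1_le_two G hd n e.val.1 e.val.2
    simp only
    linarith
  have := le_ciSup hb ⟨(x, y), h⟩
  simp only at this
  unfold TV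
  linarith

lemma TV_nonneg (n : ℕ) : 0 ≤ TV G n := by
  unfold TV
  apply Real.iSup_nonneg
  intro e
  have : 0 ≤ ∑' z, |Pmat G n e.val.1 z - Pmat G n e.val.2 z| := tsum_nonneg (fun z => abs_nonneg _)
  linarith

lemma TV_le_one (hd : ∀ x, 0 < G.degree x) (n : ℕ) : TV G n ≤ 1 := by
  unfold TV
  apply Real.iSup_le _ zero_le_one
  intro e
  have := l1_le_two G hd n e.val.1 e.val.2
  linarith

lemma l1_sum_le_TV (hd : ∀ x, 0 < G.degree x) (n : ℕ) (x y : V) (h : G.Adj x y) (U : Finset V) :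
    ∑ z ∈ U, |Pmat G n x z - Pmat G n y z| ≤ 2 * TV G n := by
  refine le_trans ?_ (l1_le_TV G hd n x y h)
  obtain ⟨U', hU⟩ := exists_supp G n {x, y}
  have hx := hU x (by simp)
  have hy := hU y (by simp)
  apply Summable.sum_le_tsum U (fun _ _ => abs_nonneg _)
  exact summable_of_ne_finset_zero (s := U') (fun z hz => by simp [hx z hz, hy z hz])

lemma l1_sum_nb (hd : ∀ x, 0 < G.degree x) (n : ℕ) (x y : V) (h : y ∈ nb G x) (U : Finset V) :
    ∑ z ∈ U, |Pmat G n y z - Pmat G n x z| ≤ 2 * TV G n := by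
  rw [mem_nb] at h
  rcases h with h | h
  · subst h; simp [TV_nonneg]
  · exact l1_sum_le_TV G hd n y x h.symm U

lemma l1_succ (hd : ∀ x, 0 < G.degree x) (n : ℕ) (x y : V) (h : y ∈ nb G x) (U : Finset V) :
    ∑ z ∈ U, |Pmat G n y z - Pmat G (n+1) x z| ≤ 4 * TV G n := by
  have h1 : ∀ z ∈ U, |Pmat G n y z - Pmat G (n+1) x z| ≤
      ∑ w ∈ nb G x, step G x w * (|Pmat G n y z - Pmat G n x z| + |Pmat G n w z - Pmat G n x z|) := by
    intro z _
    have : Pmat G n y z - Pmat G (n+1) x z =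
        ∑ w ∈ nb G x, step G x w * (Pmat G n y z - Pmat G n w z) := by
      simp only [mul_sub, Finset.sum_sub_distrib]
      rw [← Finset.sum_mul, sum_step G hd, Pmat_left, one_mul]
    rw [this]
    refine (Finset.abs_sum_le_sum_abs _ _).trans ?_
    apply Finset.sum_le_sum; intro w _
    rw [abs_mul, abs_of_nonneg (step_nonneg G x w)]
    apply mul_le_mul_of_nonneg_left _ (step_nonneg G x w)
    rw [abs_sub_comm (Pmat G n w z)]
    exact abs_sub_le _ _ _
  refine (Finset.sum_le_sum h1).trans ?_
  rw [Finset.sum_comm]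
  calc _ ≤ ∑ w ∈ nb G x, step G x w * (4 * TV G n) := by
        apply Finset.sum_le_sum; intro w hw
        rw [← Finset.mul_sum, Finset.sum_add_distrib]
        apply mul_le_mul_of_nonneg_left _ (step_nonneg G x w)
        linarith [l1_sum_nb G hd n x y h U, l1_sum_nb G hd n x w hw U]
    _ = _ := by rw [← Finset.sum_mul, sum_step G hd, one_mul]

lemma entropy_point (n : ℕ) (x z : V) :
    Real.negMulLog (Pmat G (n+1) x z) ≤ ∑ y ∈ nb G x, (step G x y * Real.negMulLog (Pmat G n y z)
      + |Pmat G n y z - Pmat G (n+1) x z|) := by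
  set μ := Pmat G (n+1) x z with hμ
  have h0 : Real.negMulLog μ = ∑ y ∈ nb G x, (step G x y * Pmat G n y z) * (-Real.log μ) := by
    rw [← Finset.sum_mul, ← Pmat_left, ← hμ, Real.negMulLog]; ring
  rw [h0]
  apply Finset.sum_le_sum; intro y hy
  have hle : step G x y * Pmat G n y z ≤ μ := by
    rw [hμ, Pmat_left]
    exact Finset.single_le_sum (f := fun y => step G x y * Pmat G n y z)
      (fun w _ => mul_nonneg (step_nonneg G x w) (Pmat_nonneg G n w z)) hy
  have hs := step_nonneg G x y
  have hν := Pmat_nonneg G n y z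
  set ν := Pmat G n y z
  set s := step G x y
  rcases (mul_nonneg hs hν).eq_or_lt with h | h
  · rw [← h, Real.negMulLog]
    have : s * (-ν * Real.log ν) = -(s*ν) * Real.log ν := by ring
    rw [this, ← h]
    simp
  · have hμ0 : 0 < μ := h.trans_le hle
    have hν0 : 0 < ν := by
      rcases hν.eq_or_lt with h' | h'
      · rw [← h', mul_zero] at h; exact absurd h (lt_irrefl _)
      · exact h'
    have hl := Real.log_le_sub_one_of_pos (div_pos hν0 hμ0)
    rw [Real.log_div hν0.ne' hμ0.ne'] at hl
    have h1 : s * ν * (Real.log ν - Real.log μ) ≤ s * ν * (ν / μ - 1) :=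
      mul_le_mul_of_nonneg_left hl h.le
    have h2 : s * ν * (ν / μ - 1) = (s * ν / μ) * (ν - μ) := by field_simp
    have h3 : (s * ν / μ) * (ν - μ) ≤ |ν - μ| := by
      have h4 : s * ν / μ ≤ 1 := (div_le_one hμ0).2 hle
      have h5 : 0 ≤ s * ν / μ := by positivity
      calc _ ≤ (s * ν / μ) * |ν - μ| := mul_le_mul_of_nonneg_left (le_abs_self _) h5
        _ ≤ _ := mul_le_of_le_one_left (abs_nonneg _) h4
    rw [Real.negMulLog]
    linarith

lemma entropy_succ (hd : ∀ x, 0 < G.degree x) (M : ℕ) (hM : ∀ x, G.degree x ≤ M)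
    (n : ℕ) (h : ℝ) (hh : ∀ y, entropy G n y ≤ h) (x : V) :
    entropy G (n+1) x ≤ h + (M + 1) * (4 * TV G n) := by
  obtain ⟨U, hU⟩ := exists_supp G n (nb G x)
  have hU' : ∀ z ∉ U, Pmat G (n+1) x z = 0 := by
    intro z hz
    rw [Pmat_left]
    exact Finset.sum_eq_zero (fun y hy => by rw [hU y hy z hz, mul_zero])
  rw [entropy_eq G _ x U hU']
  refine (Finset.sum_le_sum (fun z _ => entropy_point G n x z)).trans ?_
  rw [Finset.sum_comm]
  simp only [Finset.sum_add_distrib, ← Finset.mul_sum]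
  apply add_le_add
  · calc _ ≤ ∑ y ∈ nb G x, step G x y * h := by
          apply Finset.sum_le_sum; intro y hy
          rw [← entropy_eq G n y U (hU y hy)]
          exact mul_le_mul_of_nonneg_left (hh y) (step_nonneg G x y)
      _ = h := by rw [← Finset.sum_mul, sum_step G hd, one_mul]
  · refine (Finset.sum_le_sum (fun y hy => l1_succ G hd n x y hy U)).trans ?_
    rw [Finset.sum_const, nsmul_eq_mul]
    apply mul_le_mul_of_nonneg_right _ (by linarith [TV_nonneg G n])
    have : (nb G x).card ≤ M + 1 := by
      refine (Finset.card_insert_le _ _).trans ?_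
      rw [SimpleGraph.card_neighborFinset_eq_degree]
      linarith [hM x]
    exact_mod_cast this

lemma entropy_zero (x : V) : entropy G 0 x = 0 := by
  unfold entropy
  have : ∀ y, Real.negMulLog (Pmat G 0 x y) = 0 := by
    intro y; rw [Pmat]; split_ifs <;> simp
  simp [this]

lemma entropy_lin (hd : ∀ x, 0 < G.degree x) (M : ℕ) (hM : ∀ x, G.degree x ≤ M)
    (n : ℕ) : ∀ x, entropy G n x ≤ n * ((M + 1) * 4) := by
  induction n with
  | zero => intro x; simp [entropy_zero]
  | succ n ih =>
    intro x
    have := entropy_succ G hd M hM n _ ih x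
    have h2 : ((M:ℝ) + 1) * (4 * TV G n) ≤ (M + 1) * 4 := by
      apply mul_le_mul_of_nonneg_left _ (by positivity)
      linarith [TV_le_one G hd n]
    push_cast
    linarith

lemma entropy_le_Hstar (hd : ∀ x, 0 < G.degree x) (M : ℕ) (hM : ∀ x, G.degree x ≤ M)
    (n : ℕ) (x : V) : entropy G n x ≤ Hstar G n := by
  have hu : ∀ (x : V) (m : Fin (n+1)), entropy G m.1 x ≤ n * ((M + 1) * 4) := by
    intro x m
    refine (entropy_lin G hd M hM m.1 x).trans ?_
    apply mul_le_mul_of_nonneg_right _ (by positivity)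
    exact_mod_cast Nat.lt_succ_iff.1 m.2
  have h1 : entropy G n x ≤ ⨆ m : Fin (n+1), entropy G m.1 x :=
    le_ciSup (f := fun m : Fin (n+1) => entropy G m.1 x)
      ⟨n * ((M + 1) * 4), by rintro _ ⟨m, rfl⟩; exact hu x m⟩ (Fin.last n)
  refine h1.trans ?_
  unfold Hstar
  refine le_ciSup (f := fun x => ⨆ m : Fin (n+1), entropy G m.1 x) ?_ x
  refine ⟨n * ((M + 1) * 4), ?_⟩
  rintro _ ⟨y, rfl⟩
  exact ciSup_le (hu y)

lemma energy_decay (hd : ∀ x, 0 < G.degree x) (M : ℕ) (hM : ∀ x, G.degree x ≤ M)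
    (φ : ℝ) (hφ0 : 0 < φ) (hφ1 : φ ≤ 1)
    (hφ : ∀ W : Finset V, W.Nonempty → φ * (degSum G W : ℝ) ≤ boundaryCard G W) (z : V) (n : ℕ) :
    ∀ U : Finset V, ∑ x ∈ U, G.degree x * Pmat G n x z ^ 2 ≤ M * (1 - φ^2/4) ^ n := by
  induction n with
  | zero =>
    intro U
    have : ∀ x, (G.degree x : ℝ) * Pmat G 0 x z ^ 2 = if x = z then (G.degree z : ℝ) else 0 := by
      intro x
      by_cases h : x = z
      · subst h; simp [Pmat]
      · simp [Pmat, h]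
    simp only [this, Finset.sum_ite_eq']
    have h1 : (G.degree z : ℝ) ≤ M := by exact_mod_cast hM z
    have h2 : (0:ℝ) ≤ M := by positivity
    split_ifs <;> simp [h1, h2]
  | succ n ih =>
    intro U
    obtain ⟨S, hS⟩ := exists_supp1 G n z
    have hS' : ∀ x ∉ S, Pmat G n x z = 0 := by
      intro x hx
      have := Pmat_rev G hd n x z
      rw [hS x hx, mul_zero] at this
      have hx : (0:ℝ) < G.degree x := by exact_mod_cast hd x
      rcases mul_eq_zero.1 this with h | h
      · linarith
      · exact h
    set T := U ∪ (S ∪ S.biUnion (fun x => G.neighborFinset x)) with hT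
    have hc := contraction G φ hφ0 T S (fun x => Pmat G n x z) hd hS'
      (Finset.subset_union_left.trans Finset.subset_union_right)
      (fun x hx => (Finset.subset_biUnion_of_mem (fun x => G.neighborFinset x) hx).trans
        (Finset.subset_union_right.trans Finset.subset_union_right)) hφ
    rw [← Pmat_lazy] at hc
    have hpos : 0 ≤ 1 - φ^2/4 := by nlinarith
    calc ∑ x ∈ U, G.degree x * Pmat G (n+1) x z ^ 2 ≤ ∑ x ∈ T, G.degree x * Pmat G (n+1) x z ^ 2 :=
          Finset.sum_le_sum_of_subset_of_nonneg Finset.subset_union_left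
            (fun _ _ _ => by positivity)
      _ ≤ _ := hc
      _ ≤ (1 - φ^2/4) * (M * (1 - φ^2/4) ^ n) := mul_le_mul_of_nonneg_left (ih T) hpos
      _ = _ := by ring

end
section
variable (G : SimpleGraph V) [G.LocallyFinite]

lemma entropy_lower (hd : ∀ x, 0 < G.degree x) (c : ℝ) (n : ℕ) (x : V)
    (hc : ∀ z, 0 < Pmat G n x z → Real.log (Pmat G n x z) ≤ - c) : c ≤ entropy G n x := by
  obtain ⟨U, hU⟩ := exists_supp1 G n x
  rw [entropy_eq G n x U hU]
  calc c = ∑ z ∈ U, Pmat G n x z * c := by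
        rw [← Finset.sum_mul, Pmat_sum_eq G hd n x U hU, one_mul]
    _ ≤ _ := by
        apply Finset.sum_le_sum; intro z _
        rcases (Pmat_nonneg G n x z).eq_or_lt with h | h
        · rw [← h]; simp
        · rw [Real.negMulLog]
          nlinarith [hc z h]

lemma amenable [Nonempty V] (hd : ∀ x, 0 < G.degree x) (M : ℕ) (hM : ∀ x, G.degree x ≤ M)
    (hTV : Filter.Tendsto (TV G) Filter.atTop (nhds 0)) (ε : ℝ) (hε : 0 < ε) :
    ∃ F : Finset V, F.Nonempty ∧ (boundaryCard G F : ℝ) ≤ ε * degSum G F := by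
  by_contra hcon
  push Not at hcon
  set φ := min ε 1 with hφ
  have hφ0 : 0 < φ := lt_min hε one_pos
  have hφ1 : φ ≤ 1 := min_le_right _ _
  have hiso : ∀ W : Finset V, W.Nonempty → φ * (degSum G W : ℝ) ≤ boundaryCard G W := by
    intro W hW
    refine le_trans ?_ (hcon W hW).le
    exact mul_le_mul_of_nonneg_right (min_le_left _ _) (by positivity)
  set ρ := 1 - φ^2/4 with hρ
  have hρ0 : 0 < ρ := by nlinarith
  have hρ1 : ρ < 1 := by nlinarith
  set lam := - Real.log ρ with hlam
  have hlam0 : 0 < lam := by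
    have := Real.log_neg hρ0 hρ1
    linarith
  obtain ⟨o⟩ := ‹Nonempty V›
  have hM0 : 0 < M := (hd o).trans_le (hM o)
  have hM0' : (0:ℝ) < M := by exact_mod_cast hM0
  have lower : ∀ n x, (n * lam - Real.log M) / 2 ≤ entropy G n x := by
    intro n x
    apply entropy_lower G hd
    intro z hz
    have h1 := energy_decay G hd M hM φ hφ0 hφ1 hiso z n {x}
    rw [Finset.sum_singleton] at h1
    have h2 : (1:ℝ) ≤ G.degree x := by exact_mod_cast hd x
    have h3 : Pmat G n x z ^ 2 ≤ M * ρ ^ n := by nlinarith [sq_nonneg (Pmat G n x z)]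
    have h4 := Real.log_le_log (by positivity) h3
    rw [Real.log_pow, Real.log_mul hM0'.ne' (by positivity), Real.log_pow] at h4
    push_cast at h4
    rw [hlam]
    linarith
  have hev : ∀ᶠ n in Filter.atTop, TV G n < lam / (16 * (M + 1)) :=
    hTV.eventually (gt_mem_nhds (by positivity))
  obtain ⟨k, hk⟩ := Filter.eventually_atTop.1 hev
  have upper : ∀ j : ℕ, ∀ x, entropy G (k + j) x ≤ k * ((M + 1) * 4) + j * (lam / 4) := by
    intro j
    induction j with
    | zero => intro x; simpa using entropy_lin G hd M hM k x
    | succ j ih =>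
      intro x
      have h1 := entropy_succ G hd M hM (k + j) _ ih x
      have h2 : ((M:ℝ) + 1) * (4 * TV G (k + j)) ≤ lam / 4 := by
        have h3 := hk (k + j) (by omega)
        rw [lt_div_iff₀ (by positivity)] at h3
        linarith
      push_cast
      rw [← add_assoc]
      linarith
  obtain ⟨j, hj⟩ := exists_nat_gt ((k * ((M + 1) * 4) + Real.log M / 2) / (lam / 4))
  rw [div_lt_iff₀ (by positivity)] at hj
  have h1 := lower (k + j) o
  have h2 := upper j o
  push_cast at h1
  have h3 : (0:ℝ) ≤ k * lam := by positivity
  linarith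

lemma isoProfile_nonneg (n : ℕ) : 0 ≤ isoProfile G n := by
  unfold isoProfile
  apply Real.iInf_nonneg
  intro W
  positivity

lemma isoProfile_le (hd : ∀ x, 0 < G.degree x) (n : ℕ) (W : Finset V) (hW : W.Nonempty)
    (hn : degSum G W ≤ n) : isoProfile G n * (degSum G W : ℝ) ≤ boundaryCard G W := by
  have hpos : 0 < degSum G W := Finset.sum_pos (fun x _ => hd x) hW
  have hpos' : (0:ℝ) < degSum G W := by exact_mod_cast hpos
  rw [← le_div_iff₀ hpos']
  unfold isoProfile
  refine ciInf_le (f := fun W : {W : Finset V // W.Nonempty ∧ degSum G W ≤ n} =>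
    (boundaryCard G W.1 : ℝ) / (degSum G W.1 : ℝ)) ⟨0, ?_⟩ ⟨W, hW, hn⟩
  rintro _ ⟨W, rfl⟩
  positivity

lemma isoProfile_le_one (n : ℕ) : isoProfile G n ≤ 1 := by
  unfold isoProfile
  rcases isEmpty_or_nonempty {W : Finset V // W.Nonempty ∧ degSum G W ≤ n} with h | h
  · rw [Real.iInf_of_isEmpty]; norm_num
  · obtain ⟨W⟩ := h
    refine (ciInf_le (f := fun W : {W : Finset V // W.Nonempty ∧ degSum G W ≤ n} =>
      (boundaryCard G W.1 : ℝ) / (degSum G W.1 : ℝ)) ⟨0, ?_⟩ W).trans ?_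
    · rintro _ ⟨W, rfl⟩
      positivity
    · apply div_le_one_of_le₀ _ (by positivity)
      have : boundaryCard G W.1 ≤ degSum G W.1 := by
        apply Finset.sum_le_sum; intro x _
        rw [← SimpleGraph.card_neighborFinset_eq_degree]
        exact Finset.card_filter_le _ _
      exact_mod_cast this

lemma trunc_mass (hd : ∀ x, 0 < G.degree x) (m : ℕ) (L : ℝ) (hL : 0 < L)
    (x : V) (hH : 2 * entropy G m x ≤ L) (U : Finset V) (hU : ∀ z ∉ U, Pmat G m x z = 0) :
    1/4 ≤ ∑ z ∈ U, max (Pmat G m x z - Real.exp (-L) / 2) 0 := by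
  rw [entropy_eq G m x U hU] at hH
  have h1 : ∀ z ∈ U, Pmat G m x z ≤ 2 * max (Pmat G m x z - Real.exp (-L) / 2) 0
      + Real.negMulLog (Pmat G m x z) / L := by
    intro z _
    have hp0 := Pmat_nonneg G m x z
    have hp1 := Pmat_le_one G hd m x z
    have hn := Real.negMulLog_nonneg hp0 hp1
    set p := Pmat G m x z
    have hn' : 0 ≤ Real.negMulLog p / L := by positivity
    rcases le_or_gt (Real.exp (-L)) p with h | h
    · have := le_max_left (p - Real.exp (-L) / 2) 0
      linarith
    · have h0 := le_max_right (p - Real.exp (-L) / 2) 0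
      have : p ≤ Real.negMulLog p / L := by
        rw [le_div_iff₀ hL]
        rcases hp0.eq_or_lt with h' | h'
        · rw [← h']; simp
        · have hl := Real.log_le_log h' h.le
          rw [Real.log_exp] at hl
          rw [Real.negMulLog]
          nlinarith
      linarith
  have h2 := Finset.sum_le_sum h1
  rw [Pmat_sum_eq G hd m x U hU, Finset.sum_add_distrib, ← Finset.mul_sum, ← Finset.sum_div] at h2
  have h3 : (∑ z ∈ U, Real.negMulLog (Pmat G m x z)) / L ≤ 1/2 := by
    rw [div_le_iff₀ hL]; linarith
  linarith

lemma main_ineq [Nonempty V] (hd : ∀ x, 0 < G.degree x) (M : ℕ) (hM : ∀ x, G.degree x ≤ M)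
    (hTV : Filter.Tendsto (TV G) Filter.atTop (nhds 0)) (m n : ℕ) (L : ℝ) (hL : 0 < L)
    (hH : ∀ x, 2 * entropy G m x ≤ L) (hn : 2 * M * Real.exp L ≤ n) :
    isoProfile G n ≤ 4 * TV G m := by
  apply le_of_forall_pos_le_add
  intro ε hε
  obtain ⟨F, hF, hFb⟩ := amenable G hd M hM hTV (ε/4) (by positivity)
  set s := Real.exp (-L) / 2 with hs
  have hs0 : 0 < s := by positivity
  set f : V → V → ℝ := fun x z => max (Pmat G m x z - s) 0 with hf
  set Φ := isoProfile G n with hΦ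
  have hΦ0 : 0 ≤ Φ := isoProfile_nonneg G n
  set T := F ∪ F.biUnion (fun x => G.neighborFinset x) with hT
  have hFT : F ⊆ T := Finset.subset_union_left
  have hNT : ∀ x ∈ F, G.neighborFinset x ⊆ T := fun x hx =>
    (Finset.subset_biUnion_of_mem (fun x => G.neighborFinset x) hx).trans Finset.subset_union_right
  obtain ⟨Z, hZ⟩ := exists_supp G m T
  have hco : ∀ z ∈ Z, 2 * Φ * ∑ x ∈ T, G.degree x * (ind F x * f x z)
      ≤ ∑ x ∈ T, ∑ y ∈ T, adjR G x y * |ind F x * f x z - ind F y * f y z| := by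
    intro z _
    have hSF : F.filter (fun x => s < Pmat G m x z) ⊆ F := Finset.filter_subset _ _
    apply coarea G Φ T (F.filter (fun x => s < Pmat G m x z)) (fun x => ind F x * f x z)
    · intro x hx
      by_cases hxF : x ∈ F
      · have : ¬ s < Pmat G m x z := fun h => hx (Finset.mem_filter.2 ⟨hxF, h⟩)
        have h0 : f x z = 0 := max_eq_right (by linarith)
        simp [h0]
      · simp [ind, hxF]
    · intro x
      apply mul_nonneg
      · unfold ind; split_ifs <;> norm_num
      · exact le_max_right _ _
    · exact hSF.trans hFT
    · intro x hx; exact hNT x (hSF hx)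
    · intro W hW hWn
      apply isoProfile_le G hd n W hWn
      have h1 : s * (degSum G W : ℝ) ≤ M := by
        calc s * (degSum G W : ℝ) = ∑ x ∈ W, G.degree x * s := by
              unfold degSum; push_cast; rw [mul_comm, Finset.sum_mul]
          _ ≤ ∑ x ∈ W, G.degree x * Pmat G m x z := by
              apply Finset.sum_le_sum; intro x hx
              exact mul_le_mul_of_nonneg_left (Finset.mem_filter.1 (hW hx)).2.le (by positivity)
          _ = G.degree z * ∑ x ∈ W, Pmat G m z x := by
              rw [Finset.mul_sum]
              exact Finset.sum_congr rfl (fun x _ => Pmat_rev G hd m x z)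
          _ ≤ G.degree z * 1 := mul_le_mul_of_nonneg_left (Pmat_sum_le G hd m z W) (by positivity)
          _ ≤ M := by rw [mul_one]; exact_mod_cast hM z
      have h2 : (degSum G W : ℝ) ≤ n := by
        refine le_trans ?_ hn
        have h3 : (degSum G W : ℝ) = 2 * Real.exp L * (s * degSum G W) := by
          rw [hs, Real.exp_neg]; field_simp
        rw [h3]
        calc _ ≤ 2 * Real.exp L * M := mul_le_mul_of_nonneg_left h1 (by positivity)
          _ = _ := by ring
      exact_mod_cast h2
  have hsum := Finset.sum_le_sum hco
  have hdF : ∑ x ∈ T, G.degree x * ind F x = (degSum G F : ℝ) := by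
    unfold degSum ind
    push_cast
    simp only [mul_ite, mul_one, mul_zero, ← Finset.sum_filter]
    apply Finset.sum_congr _ (fun _ _ => rfl)
    ext x; simp only [Finset.mem_filter]
    exact ⟨fun h => h.2, fun h => ⟨hFT h, h⟩⟩
  have hind0 : ∀ x, 0 ≤ ind F x := by intro x; unfold ind; split_ifs <;> norm_num
  have hleft : 2 * Φ * (degSum G F / 4) ≤
      ∑ z ∈ Z, 2 * Φ * ∑ x ∈ T, G.degree x * (ind F x * f x z) := by
    rw [← Finset.mul_sum]
    apply mul_le_mul_of_nonneg_left _ (by positivity)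
    rw [Finset.sum_comm, ← hdF, Finset.sum_div]
    apply Finset.sum_le_sum; intro x hx
    rw [← Finset.mul_sum, ← Finset.mul_sum, ← mul_assoc]
    have h1 := trunc_mass G hd m L hL x (hH x) Z (hZ x hx)
    have h2 : 0 ≤ (G.degree x : ℝ) * ind F x := mul_nonneg (by positivity) (hind0 x)
    calc _ = (G.degree x : ℝ) * ind F x * (1/4) := by ring
      _ ≤ _ := mul_le_mul_of_nonneg_left h1 h2
  have hright : ∑ z ∈ Z, ∑ x ∈ T, ∑ y ∈ T, adjR G x y * |ind F x * f x z - ind F y * f y z|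
      ≤ degSum G F * (2 * TV G m) + 2 * boundaryCard G F := by
    rw [← sum_ind_boundary G T F hFT hNT, Finset.sum_comm, ← hdF, Finset.sum_mul,
      ← Finset.sum_add_distrib]
    apply Finset.sum_le_sum; intro x hx
    rw [Finset.sum_comm]
    have h1 : (∑ y ∈ T, adjR G x y) * (ind F x * (2 * TV G m)) ≤ G.degree x * ind F x * (2 * TV G m) := by
      rw [mul_assoc]
      exact mul_le_mul_of_nonneg_right (sum_adjR_le G T x)
        (mul_nonneg (hind0 x) (by linarith [TV_nonneg G m]))
    refine le_trans ?_ (add_le_add_left h1 _)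
    rw [Finset.sum_mul, ← Finset.sum_add_distrib]
    apply Finset.sum_le_sum; intro y hy
    rw [← Finset.mul_sum, ← mul_add]
    by_cases ha : G.Adj x y
    · apply mul_le_mul_of_nonneg_left _ (adjR_nonneg G x y)
      calc _ ≤ ∑ z ∈ Z, (ind F x * |Pmat G m x z - Pmat G m y z| + |ind F x - ind F y| * Pmat G m y z) := by
            apply Finset.sum_le_sum; intro z _
            have e : ind F x * f x z - ind F y * f y z
              = ind F x * (f x z - f y z) + (ind F x - ind F y) * f y z := by ring
            rw [e]
            refine (abs_add_le _ _).trans ?_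
            rw [abs_mul, abs_mul, abs_of_nonneg (hind0 x)]
            apply add_le_add
            · apply mul_le_mul_of_nonneg_left _ (hind0 x)
              refine (abs_max_sub_max_le_abs _ _ _).trans ?_
              rw [sub_sub_sub_cancel_right]
            · apply mul_le_mul_of_nonneg_left _ (abs_nonneg _)
              rw [abs_of_nonneg (le_max_right _ _)]
              apply max_le _ (Pmat_nonneg G m y z)
              linarith
        _ ≤ _ := by
            rw [Finset.sum_add_distrib, ← Finset.mul_sum, ← Finset.mul_sum]
            apply add_le_add
            · exact mul_le_mul_of_nonneg_left (l1_sum_le_TV G hd m x y ha Z) (hind0 x)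
            · exact mul_le_of_le_one_right (abs_nonneg _) (Pmat_sum_le G hd m y Z)
    · simp [adjR, ha]
  have hpos : 0 < degSum G F := Finset.sum_pos (fun x _ => hd x) hF
  have hpos' : (0:ℝ) < degSum G F := by exact_mod_cast hpos
  have hfin : Φ * degSum G F ≤ (4 * TV G m + ε) * degSum G F := by linarith
  exact le_of_mul_le_mul_right hfin hpos'

end

/-- isoperimetric profile bound from entropy growth and TV decay. -/
theorem statement1 (V : Type) [Infinite V] (G : SimpleGraph V) [G.LocallyFinite]
    (hconn : G.Connected) (M : ℕ) (hdeg : ∀ v : V, G.degree v ≤ M)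
    (A B α β : ℝ) (hα : 0 < α) (hα1 : α ≤ 1) (hβ : 0 < β) (hβ1 : β ≤ 1)
    (hH : ∀ n : ℕ, 1 ≤ n → Hstar G n ≤ A * (n : ℝ) ^ α)
    (hTV : ∀ n : ℕ, 1 ≤ n → TV G n ≤ B * (n : ℝ) ^ (-β)) :
    ∃ C : ℝ, ∀ n : ℕ, 3 ≤ n →
      isoProfile G n ≤ C * (Real.log (Real.log n) / Real.log n) ^ (β / α) := by
  have hd : ∀ x, 0 < G.degree x := fun x => hconn.preconnected.degree_pos_of_nontrivial x
  obtain ⟨o⟩ : Nonempty V := inferInstance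
  have : Nonempty V := ⟨o⟩
  have hM1 : (1:ℝ) ≤ M := by exact_mod_cast (hd o).trans_le (hdeg o)
  have hT0 : Filter.Tendsto (TV G) Filter.atTop (nhds 0) := by
    have h1 : Filter.Tendsto (fun n : ℕ => B * (n : ℝ) ^ (-β)) Filter.atTop (nhds 0) := by
      have := ((tendsto_rpow_neg_atTop hβ).comp tendsto_natCast_atTop_atTop).const_mul B
      simpa using this
    refine squeeze_zero' (Filter.Eventually.of_forall (fun n => TV_nonneg G n)) ?_ h1
    filter_upwards [Filter.eventually_ge_atTop 1] with n hn using hTV n hn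
  set A' := max A 1 with hA'
  have hA1 : 1 ≤ A' := le_max_right _ _
  set B' := |B| with hB'
  set γ := β / α with hγ
  have hγ0 : 0 < γ := by positivity
  set K := max (2 * Real.log (2 * M)) (4 * A') with hK
  have hK0 : 0 < K := by
    have : 4 * A' ≤ K := le_max_right _ _
    linarith
  set C1 := max (K ^ γ) (4 * B' * 2 ^ β * (4 * A') ^ γ) with hC1
  have hC10 : 0 ≤ C1 := (Real.rpow_nonneg hK0.le γ).trans (le_max_left _ _)
  have hl3 : 1 < Real.log 3 := by
    rw [Real.lt_log_iff_exp_lt (by norm_num)]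
    linarith [Real.exp_one_lt_d9]
  have hll3 : 0 < Real.log (Real.log 3) := Real.log_pos hl3
  refine ⟨C1 / Real.log (Real.log 3) ^ γ, fun n hn => ?_⟩
  have hn3 : (3:ℝ) ≤ n := by exact_mod_cast hn
  have hln : Real.log 3 ≤ Real.log n := Real.log_le_log (by norm_num) hn3
  have hlln : Real.log (Real.log 3) ≤ Real.log (Real.log n) :=
    Real.log_le_log (by linarith) hln
  have hlpos : 0 < Real.log n := by linarith
  have hkey : isoProfile G n ≤ C1 / Real.log n ^ γ := by
    have hlg : 0 < Real.log n ^ γ := Real.rpow_pos_of_pos hlpos γ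
    rw [le_div_iff₀ hlg]
    rcases le_or_gt (Real.log n) K with hc | hc
    · calc _ ≤ 1 * Real.log n ^ γ := mul_le_mul_of_nonneg_right (isoProfile_le_one G n) hlg.le
        _ = Real.log n ^ γ := one_mul _
        _ ≤ K ^ γ := Real.rpow_le_rpow hlpos.le hc hγ0.le
        _ ≤ C1 := le_max_left _ _
    · have hc1 : 2 * Real.log (2 * M) ≤ Real.log n := (le_max_left _ _).trans hc.le
      have hc2 : 4 * A' ≤ Real.log n := (le_max_right _ _).trans hc.le
      set v := Real.log n / (4 * A') with hv
      have hv1 : 1 ≤ v := by rw [hv, le_div_iff₀ (by positivity)]; linarith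
      set u := v ^ (1/α) with hu
      have hu1 : 1 ≤ u := Real.one_le_rpow hv1 (by positivity)
      set m := ⌊u⌋₊ with hm
      have hm1 : 1 ≤ m := Nat.le_floor (by simpa using hu1)
      have hm1' : (1:ℝ) ≤ m := by exact_mod_cast hm1
      have hmu : (m:ℝ) ≤ u := Nat.floor_le (by linarith)
      have hmu2 : u / 2 ≤ m := by
        have := Nat.lt_floor_add_one u
        rw [← hm] at this
        linarith
      have huα : u ^ α = v := by
        rw [hu, ← Real.rpow_mul (by linarith), one_div, inv_mul_cancel₀ hα.ne', Real.rpow_one]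
      have hmα : (m:ℝ) ^ α ≤ v := by
        rw [← huα]; exact Real.rpow_le_rpow (by linarith) hmu hα.le
      have hmα0 : 0 < (m:ℝ) ^ α := Real.rpow_pos_of_pos (by linarith) α
      have h1 := main_ineq G hd M hdeg hT0 m n (Real.log n / 2) (by linarith)
        (by
          intro x
          have h2 := (entropy_le_Hstar G hd M hdeg m x).trans (hH m hm1)
          have h3 : A * (m:ℝ) ^ α ≤ A' * v :=
            (mul_le_mul_of_nonneg_right (le_max_left A 1) hmα0.le).trans
              (mul_le_mul_of_nonneg_left hmα (by linarith))
          have h4 : A' * v = Real.log n / 4 := by rw [hv]; field_simp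
          linarith)
        (by
          have h5 : (2 * M : ℝ) = Real.exp (Real.log (2 * M)) := (Real.exp_log (by linarith)).symm
          rw [h5, ← Real.exp_add]
          calc _ ≤ Real.exp (Real.log n) := Real.exp_le_exp.2 (by linarith)
            _ = n := Real.exp_log (by linarith))
      have h6 : TV G m ≤ B' * (u / 2) ^ (-β) := by
        refine (hTV m hm1).trans ?_
        calc _ ≤ B' * (m:ℝ) ^ (-β) :=
              mul_le_mul_of_nonneg_right (le_abs_self B) (Real.rpow_nonneg (by linarith) _)
          _ ≤ _ := mul_le_mul_of_nonneg_left
              (Real.rpow_le_rpow_of_nonpos (by linarith) hmu2 (by linarith)) (abs_nonneg B)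
      have h7 : (u / 2) ^ (-β) * Real.log n ^ γ = 2 ^ β * (4 * A') ^ γ := by
        have e1 : (u / 2) ^ (-β) = 2 ^ β * (v ^ γ)⁻¹ := by
          rw [Real.rpow_neg (by linarith), Real.div_rpow (by linarith) (by norm_num), hu,
            ← Real.rpow_mul (by linarith), one_div_mul_eq_div, ← hγ, inv_div, div_eq_mul_inv]
        have e2 : Real.log n ^ γ = v ^ γ * (4 * A') ^ γ := by
          rw [← Real.mul_rpow (by linarith) (by linarith), hv, div_mul_cancel₀ _ (by positivity)]
        have e3 : 0 < v ^ γ := Real.rpow_pos_of_pos (by linarith) γ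
        rw [e1, e2]
        field_simp
      calc isoProfile G n * Real.log n ^ γ ≤ (4 * (B' * (u / 2) ^ (-β))) * Real.log n ^ γ :=
            mul_le_mul_of_nonneg_right (by linarith) hlg.le
        _ = 4 * B' * ((u / 2) ^ (-β) * Real.log n ^ γ) := by ring
        _ = 4 * B' * 2 ^ β * (4 * A') ^ γ := by rw [h7]; ring
        _ ≤ C1 := le_max_right _ _
  refine hkey.trans ?_
  have g1 : 0 < Real.log (Real.log 3) ^ γ := Real.rpow_pos_of_pos hll3 γ
  have g2 : Real.log (Real.log 3) ^ γ ≤ Real.log (Real.log n) ^ γ :=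
    Real.rpow_le_rpow hll3.le hlln hγ0.le
  have g3 : 0 ≤ C1 / Real.log n ^ γ := div_nonneg hC10 (Real.rpow_nonneg hlpos.le γ)
  have g4 : 1 ≤ Real.log (Real.log n) ^ γ / Real.log (Real.log 3) ^ γ :=
    (one_le_div g1).2 g2
  rw [Real.div_rpow (by linarith) hlpos.le]
  calc C1 / Real.log n ^ γ ≤ (C1 / Real.log n ^ γ) *
        (Real.log (Real.log n) ^ γ / Real.log (Real.log 3) ^ γ) := le_mul_of_one_le_right g3 g4
    _ = _ := by ring

end LazyRW
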